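/- The number of Dyck paths of order n with exactly k peaks equals (1/n)·C(n,k)·C(n,k-1) (the Narayana number). -/

import Mathlib

def IsPeakAt (w : List Bool) (i : ℕ) : Prop :=
  w[i]? = some true ∧ w[i + 1]? = some false

def IsDyck (w : List Bool) : Prop :=
  w.count true = w.count false ∧ ∀ p, p <+: w → p.count false ≤ p.count true

namespace NarayanaAux

/-- recursive number of peaks -/
def pk : List Bool → ℕ
  | [] => 0
  | b :: w => pk w + if b = true ∧ w[0]? = some false then 1 else 0

lemma peaks_finite (w : List Bool) : {i : ℕ | IsPeakAt w i}.Finite := by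
  apply (Set.finite_Iio w.length).subset
  rintro i ⟨h, -⟩
  exact (List.getElem?_eq_some_iff.1 h).1

lemma card_peaks (w : List Bool) : {i : ℕ | IsPeakAt w i}.ncard = pk w := by
  induction w with
  | nil => simp [IsPeakAt, pk]
  | cons b w ih =>
    have hs : (Nat.succ '' {i : ℕ | IsPeakAt w i}).ncard = pk w := by
      rw [Set.ncard_image_of_injective _ Nat.succ_injective, ih]
    by_cases h : b = true ∧ w[0]? = some false
    · have : {i : ℕ | IsPeakAt (b :: w) i} = insert 0 (Nat.succ '' {i : ℕ | IsPeakAt w i}) := by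
        ext i
        cases i with
        | zero => simpa [IsPeakAt] using h
        | succ i => simp [IsPeakAt]
      rw [this, Set.ncard_insert_of_notMem (by simp) ((peaks_finite w).image _), hs, pk, if_pos h]
    · have : {i : ℕ | IsPeakAt (b :: w) i} = Nat.succ '' {i : ℕ | IsPeakAt w i} := by
        ext i
        cases i with
        | zero => simpa [IsPeakAt] using h
        | succ i => simp [IsPeakAt]
      rw [this, hs, pk, if_neg h, add_zero]

def good (w : List Bool) : Prop := ∀ s, s <:+ w → s.count true ≤ s.count false

lemma good_cons (b : Bool) (w : List Bool) :
    good (b :: w) ↔ (b :: w).count true ≤ (b :: w).count false ∧ good w := by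
  simp only [good, List.suffix_cons_iff, forall_eq_or_imp]

/-- words with `u` ups, `d` downs, `k` peaks, first letter `c`, good suffixes -/
def S (c : Bool) (u d k : ℕ) : Set (List Bool) :=
  {w | w[0]? = some c ∧ w.count true = u ∧ w.count false = d ∧ good w ∧ pk w = k}

lemma S_finite (c : Bool) (u d k : ℕ) : (S c u d k).Finite := by
  apply (List.finite_length_eq Bool (u + d)).subset
  rintro w ⟨-, h1, h2, -⟩
  have := List.count_true_add_count_false w
  simp only [Set.mem_ofPred_eq]; omega

lemma S_empty (c : Bool) (u d k : ℕ) (h : d < u) : S c u d k = ∅ := by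
  ext w
  simp only [S, Set.mem_ofPred_eq, Set.mem_empty_iff_false, iff_false]
  rintro ⟨-, h1, h2, h3, -⟩
  have := h3 w (List.suffix_refl w)
  omega

lemma S_disj (u d k u' d' k' : ℕ) : Disjoint (S true u d k) (S false u' d' k') := by
  rw [Set.disjoint_left]
  rintro w ⟨h, -⟩ ⟨h', -⟩
  simp [h] at h'

lemma S_false_succ (u d k : ℕ) (h : 0 < u + d) :
    (S false u (d + 1) k).ncard = (S true u d k).ncard + (S false u d k).ncard := by
  rw [← Set.ncard_union_eq (S_disj _ _ _ _ _ _) (S_finite _ _ _ _) (S_finite _ _ _ _),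
    ← Set.ncard_image_of_injective (S true u d k ∪ S false u d k) (List.cons_injective (a := false))]
  congr 1
  ext w
  rcases w with _ | ⟨b, w⟩
  · simp [S]
  rcases w with _ | ⟨c, w⟩
  · cases b <;> simp [S, pk] <;> omega
  have hg : good (c :: w) → (c :: w).count true ≤ (c :: w).count false :=
    fun h => h _ (List.suffix_refl _)
  simp only [S, Set.mem_image, Set.mem_union, Set.mem_ofPred_eq, good_cons b]
  cases b <;> cases c <;> simp [pk] at hg ⊢ <;> grind

lemma S_true_succ (u d k : ℕ) (h : u + 1 ≤ d) :
    (S true (u + 1) d (k + 1)).ncard = (S true u d (k + 1)).ncard + (S false u d k).ncard := by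
  rw [← Set.ncard_union_eq (S_disj _ _ _ _ _ _) (S_finite _ _ _ _) (S_finite _ _ _ _),
    ← Set.ncard_image_of_injective (S true u d (k + 1) ∪ S false u d k) (List.cons_injective (a := true))]
  congr 1
  ext w
  rcases w with _ | ⟨b, w⟩
  · simp [S]
  rcases w with _ | ⟨c, w⟩
  · cases b <;> simp [S, pk]
  simp only [S, Set.mem_image, Set.mem_union, Set.mem_ofPred_eq, good_cons b]
  cases b <;> cases c <;> simp [pk] <;> grind

lemma S_true_zero_right (u d : ℕ) : S true u d 0 = ∅ := by
  have key : ∀ w : List Bool, good w → w[0]? = some true → pk w ≠ 0 := by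
    intro w
    induction w with
    | nil => simp
    | cons b w ih =>
      rintro hg hb
      rw [good_cons] at hg
      rcases w with _ | ⟨c, w⟩
      · simp at hb; subst hb; simp at hg
      · cases c
        · simp at hb; subst hb; simp [pk]
        · have := ih hg.2 (by simp)
          rw [pk]; omega
  ext w
  simp only [S, Set.mem_ofPred_eq, Set.mem_empty_iff_false, iff_false]
  rintro ⟨h, -, -, hg, h3⟩
  exact key w hg h h3

lemma S_true_zero (d k : ℕ) : S true 0 d k = ∅ := by
  ext w
  simp only [S, Set.mem_ofPred_eq, Set.mem_empty_iff_false, iff_false]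
  rintro ⟨h, h1, -⟩
  rcases w with _ | ⟨b, w⟩
  · simp at h
  · simp at h; subst h; simp at h1

lemma S_false_one (k : ℕ) : (S false 0 1 k).ncard = if k = 0 then 1 else 0 := by
  have : S false 0 1 k = if k = 0 then {[false]} else ∅ := by
    ext w
    rcases w with _ | ⟨b, w⟩
    · split_ifs <;> simp [S]
    rcases w with _ | ⟨c, w⟩
    · cases b <;> split_ifs <;> simp [S, pk, good, List.suffix_cons_iff] <;> omega
    · cases b <;> cases c <;> split_ifs <;> simp [S]
  rw [this]; split_ifs <;> simp

lemma S_false_zero (d k : ℕ) : (S false 0 (d + 1) k).ncard = if k = 0 then 1 else 0 := by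
  induction d with
  | zero => exact S_false_one k
  | succ d ih => rw [S_false_succ _ _ _ (by omega), ih, S_true_zero]; simp

lemma main (m : ℕ) : ∀ a b : ℕ, a + b = m → a ≤ b →
    (∀ k, ((S false (a + 1) (b + 1) k).ncard : ℤ)
      = (a + 1).choose k * b.choose k - a.choose k * (b + 1).choose k) ∧
    (∀ j, ((S true (a + 1) (b + 1) (j + 1)).ncard : ℤ)
      = (a + 1).choose (j + 1) * b.choose j - a.choose (j + 1) * (b + 1).choose j) := by
  induction m using Nat.strong_induction_on with
  | _ m ih =>
  intro a b hm hab
  constructor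
  · intro k
    rw [S_false_succ _ _ _ (by omega)]
    rcases hab.eq_or_lt with rfl | hlt
    · rw [S_empty _ _ _ _ (by omega), S_empty _ _ _ _ (by omega)]
      simp; ring
    · obtain ⟨c, rfl⟩ : ∃ c, b = c + 1 := ⟨b - 1, by omega⟩
      obtain ⟨h1, h2⟩ := ih (a + c) (by omega) a c rfl (by omega)
      push_cast
      rw [h1]
      rcases k with _ | j
      · rw [S_true_zero_right]; simp
      · rw [h2]
        simp only [Nat.choose_succ_succ]
        push_cast
        ring
  · intro j
    rw [S_true_succ _ _ _ (by omega)]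
    rcases a with _ | a
    · rw [S_true_zero, S_false_zero]
      rcases j with _ | j <;> simp [Nat.choose_succ_succ]
    · obtain ⟨h1, h2⟩ := ih (a + b) (by omega) a b rfl (by omega)
      push_cast
      rw [h1, h2]
      simp only [Nat.choose_succ_succ]
      push_cast
      ring

lemma isDyck_iff (w : List Bool) : IsDyck w ↔ w.count true = w.count false ∧ good w := by
  unfold IsDyck good
  refine and_congr_right fun h => ⟨fun H s hs => ?_, fun H p hp => ?_⟩
  · obtain ⟨p, rfl⟩ := hs
    have := H p (List.prefix_append _ _)
    simp only [List.count_append] at h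
    omega
  · obtain ⟨s, rfl⟩ := hp
    have := H s (List.suffix_append _ _)
    simp only [List.count_append] at h
    omega

lemma set_eq (a k : ℕ) : {w : List Bool | w.length = 2 * (a + 1) ∧ IsDyck w ∧
        Nat.card {i : ℕ // IsPeakAt w i} = k} = S true (a + 1) (a + 1) k := by
  ext w
  have hc : Nat.card {i : ℕ // IsPeakAt w i} = pk w := card_peaks w
  have hl := List.count_true_add_count_false w
  simp only [Set.mem_ofPred_eq, hc, isDyck_iff, S]
  constructor
  · rintro ⟨h1, ⟨h2, h3⟩, h4⟩
    refine ⟨?_, by omega, by omega, h3, h4⟩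
    rcases w with _ | ⟨b, w⟩
    · simp at h1
    · cases b
      · have := h3 w (List.suffix_cons _ _)
        simp at h2
        omega
      · simp
  · rintro ⟨-, h1, h2, h3, h4⟩
    exact ⟨by omega, ⟨by omega, h3⟩, h4⟩

end NarayanaAux

/-- The number of Dyck paths of order `n` with exactly `k` peaks is the
Narayana number `(1/n)·C(n,k)·C(n,k-1)`. -/
theorem dyck_k_peaks_narayana (n k : ℕ) (hn : 1 ≤ n) (hk1 : 1 ≤ k) (hkn : k ≤ n) :
    (Nat.card {w : List Bool //
        w.length = 2 * n ∧ IsDyck w ∧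
        Nat.card {i : ℕ // IsPeakAt w i} = k} : ℚ) =
      (1 / n) * (n.choose k) * (n.choose (k - 1)) := by
  obtain ⟨a, rfl⟩ : ∃ a, n = a + 1 := ⟨n - 1, by omega⟩
  obtain ⟨j, rfl⟩ : ∃ j, k = j + 1 := ⟨k - 1, by omega⟩
  have h0 : Nat.card {w : List Bool // w.length = 2 * (a + 1) ∧ IsDyck w ∧
        Nat.card {i : ℕ // IsPeakAt w i} = j + 1}
      = (NarayanaAux.S true (a + 1) (a + 1) (j + 1)).ncard := by
    rw [← NarayanaAux.set_eq]; rfl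
  have h1 := (NarayanaAux.main (a + a) a a rfl le_rfl).2 j
  have h2 : ((NarayanaAux.S true (a + 1) (a + 1) (j + 1)).ncard : ℚ)
      = (a + 1).choose (j + 1) * a.choose j - a.choose (j + 1) * (a + 1).choose j := by
    exact_mod_cast h1
  rw [h0, h2, Nat.add_sub_cancel]
  have e1 : ((a : ℚ) + 1) * a.choose j = (a + 1).choose (j + 1) * (j + 1) := by
    exact_mod_cast Nat.add_one_mul_choose_eq a j
  have e2 : ((a + 1).choose (j + 1) : ℚ) = a.choose j + a.choose (j + 1) := by
    exact_mod_cast Nat.choose_succ_succ a j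
  have e3 : ((a + 1).choose (j + 1) : ℚ) * (j + 1) = (a + 1).choose j * (a + 1 - j) := by
    have := Nat.choose_succ_right_eq (a + 1) j
    have hc : ((a + 1 - j : ℕ) : ℚ) = a + 1 - j := by
      rw [Nat.cast_sub (by omega)]; push_cast; ring
    rw [← hc]; exact_mod_cast this
  have hne : ((a : ℚ) + 1) ≠ 0 := by positivity
  push_cast
  field_simp
  generalize ((a + 1).choose (j + 1) : ℚ) = X at *
  generalize ((a + 1).choose j : ℚ) = Y at *
  generalize (a.choose j : ℚ) = p at *
  generalize (a.choose (j + 1) : ℚ) = q at *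
  have hq : q = X - p := by linarith
  subst hq
  linear_combination (X + Y) * e1 + X * e3
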